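/- arXiv:1404.2624 — 2 statements merged into one kernel-verified Lean document; each statement's English description precedes it below -/
import Mathlib

section
/- Let V be a finite set of at least 3 points in the Euclidean plane ℝ². Then the number N(V) of double-normal pairs of V satisfies N(V) ≤ 3·⌊|V|/2⌋. -/
open scoped RealInnerProductSpace Classical

noncomputable section

abbrev Euc (d : ℕ) : Type := EuclideanSpace ℝ (Fin d)

/-- `{p, q}` is a double-normal pair of the finite point set `V`. -/
def IsDNPair {d : ℕ} (V : Finset (Euc d)) (p q : Euc d) : Prop :=
  p ∈ V ∧ q ∈ V ∧ p ≠ q ∧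
    ∀ v ∈ V, 0 ≤ ⟪v - p, q - p⟫ ∧ 0 ≤ ⟪v - q, p - q⟫

/-- `N(V)`: the number of (unordered) double-normal pairs of `V`. -/
def numDN {d : ℕ} (V : Finset (Euc d)) : ℕ :=
  ((V ×ˢ V).filter fun pq => IsDNPair V pq.1 pq.2).card / 2

/-- `{p, q}` is a strict double-normal pair of `V`. -/
def IsStrictDNPair {d : ℕ} (V : Finset (Euc d)) (p q : Euc d) : Prop :=
  IsDNPair V p q ∧
    ∀ v ∈ V, v ≠ p → v ≠ q → 0 < ⟪v - p, q - p⟫ ∧ 0 < ⟪v - q, p - q⟫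

/-- `N'(V)`: the number of (unordered) strict double-normal pairs of `V`. -/
def numStrictDN {d : ℕ} (V : Finset (Euc d)) : ℕ :=
  ((V ×ˢ V).filter fun pq => IsStrictDNPair V pq.1 pq.2).card / 2

theorem sq0 {a b : ℝ} (h : a*a+b*b ≤ 0) : a = 0 ∧ b = 0 := by
  constructor <;> nlinarith [mul_self_nonneg a, mul_self_nonneg b]

theorem core1 (w1 w2 x1 x2 e1 e2 : ℝ) (hB : 0 < w1*x2-w2*x1) (hA : 0 < e1*w2-e2*w1)
  (d1 : 0 ≤ (x1-w1)*e1+(x2-w2)*e2) (d2 : 0 ≤ (x1-w1)*x1+(x2-w2)*x2)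
  (y1 : 0 ≤ (w1+e1)*x1+(w2+e2)*x2) (y2 : 0 ≤ (w1+e1)*e1+(w2+e2)*e2)
  (hwe : w1*e1+w2*e2 ≤ 0) (hwx : 0 ≤ w1*x1+w2*x2) :
  e1 = -x1 ∧ e2 = -x2 ∧ w1*x1+w2*x2 = x1*x1+x2*x2 := by
  obtain ⟨A, hAd⟩ : ∃ A, A = e1*w2-e2*w1 := ⟨_, rfl⟩
  obtain ⟨B, hBd⟩ : ∃ A, A = w1*x2-w2*x1 := ⟨_, rfl⟩
  obtain ⟨k, hk⟩ : ∃ A, A = e1*x2-e2*x1 := ⟨_, rfl⟩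
  obtain ⟨X, hX⟩ : ∃ A, A = x1*x1+x2*x2 := ⟨_, rfl⟩
  obtain ⟨Q, hQ⟩ : ∃ A, A = e1*e1+e2*e2 := ⟨_, rfl⟩
  obtain ⟨c, hc⟩ : ∃ A, A = x1*e1+x2*e2 := ⟨_, rfl⟩
  obtain ⟨p, hp⟩ : ∃ A, A = w1*x1+w2*x2 := ⟨_, rfl⟩
  obtain ⟨q, hq⟩ : ∃ A, A = w1*e1+w2*e2 := ⟨_, rfl⟩
  have r1 : k*p = A*X+B*c := by subst_vars; ring
  have r2 : k*q = A*c+B*Q := by subst_vars; ring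
  have r3 : X*Q = c^2+k^2 := by subst_vars; ring
  have d1' : q ≤ c := by subst_vars; linarith
  have d2' : p ≤ X := by subst_vars; linarith
  have y1' : 0 ≤ p + c := by subst_vars; linarith
  have y2' : 0 ≤ q + Q := by subst_vars; linarith
  clear d1 d2 y1 y2
  rw [← hAd] at hA
  rw [← hBd] at hB
  rw [← hq] at hwe
  rw [← hp] at hwx
  have hXp : 0 < X := by
    by_contra hh; push Not at hh
    rw [hX] at hh
    obtain ⟨a1, a2⟩ := sq0 hh
    rw [a1, a2] at hBd; linarith
  have hQp : 0 < Q := by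
    by_contra hh; push Not at hh
    rw [hQ] at hh
    obtain ⟨a1, a2⟩ := sq0 hh
    rw [a1, a2] at hAd; linarith
  rcases lt_trichotomy k 0 with h | h | h
  · exfalso
    have s1 : A*X + B*c + k*c ≤ 0 := by linarith [mul_nonneg (neg_nonneg.2 h.le) y1']
    have s2 : A*c+B*Q+k*Q ≤ 0 := by linarith [mul_nonneg (neg_nonneg.2 h.le) y2']
    have s3 : c < 0 := by
      have : A*X+B*c ≤ 0 := by linarith [mul_nonneg (neg_nonneg.2 h.le) hwx]
      by_contra hh; push Not at hh
      linarith [mul_pos hA hXp, mul_nonneg hB.le hh]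
    have s4 : 0 < B + k := by
      by_contra hh; push Not at hh
      linarith [mul_pos hA hXp, mul_nonneg_of_nonpos_of_nonpos hh s3.le]
    have s5 : A*X ≤ (B+k)*(-c) := by linarith
    have s6 : (B+k)*Q ≤ A*(-c) := by linarith
    have := mul_le_mul s5 s6 (by positivity) (mul_nonneg s4.le (by linarith))
    have s7 : (A*(B+k))*(X*Q) ≤ (A*(B+k))*c^2 := by linarith
    have s8 := le_of_mul_le_mul_left s7 (mul_pos hA s4)
    linarith [sq_pos_of_neg h]
  · rw [h] at r1 r2 hk
    have e1' : A*x1+B*e1 = 0 := by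
      have : A*x1+B*e1 = w1*(e1*x2-e2*x1) := by rw [hAd, hBd]; ring
      rw [this, ← hk]; ring
    have e2' : A*x2+B*e2 = 0 := by
      have : A*x2+B*e2 = w2*(e1*x2-e2*x1) := by rw [hAd, hBd]; ring
      rw [this, ← hk]; ring
    have t1 : B*(c-q) = -A*(X-p) := by
      rw [hc, hq, hX, hp]; linear_combination (x1-w1)*e1' + (x2-w2)*e2'
    have t2 : p = X := by
      have : A*(X-p) = 0 := by linarith [mul_nonneg hB.le (sub_nonneg.2 d1'), mul_nonneg hA.le (sub_nonneg.2 d2')]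
      linarith [(mul_eq_zero.1 this).resolve_left hA.ne']
    have t3 : B*(q+Q) = -A*(p+c) := by
      rw [hc, hq, hQ, hp]; linear_combination (w1+e1)*e1' + (w2+e2)*e2'
    have t4 : p + c = 0 := by
      have : A*(p+c) = 0 := by linarith [mul_nonneg hB.le y2', mul_nonneg hA.le y1']
      linarith [(mul_eq_zero.1 this).resolve_left hA.ne']
    have t5 : A = B := by
      have hcX : c = -X := by linarith
      have : X*(A-B)=0 := by rw [hcX] at r1; linarith
      rcases mul_eq_zero.1 this with h | h <;> linarith
    subst t5
    have z1 : A*(x1+e1)=0 := by linarith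
    have z2 : A*(x2+e2)=0 := by linarith
    have := (mul_eq_zero.1 z1).resolve_left hA.ne'
    have := (mul_eq_zero.1 z2).resolve_left hA.ne'
    exact ⟨by linarith, by linarith, by rw [← hp, ← hX, t2]⟩
  · exfalso
    have s3 : c < 0 := by
      have : A*c+B*Q ≤ 0 := by linarith [mul_nonneg h.le (neg_nonneg.2 hwe)]
      by_contra hh; push Not at hh
      linarith [mul_pos hB hQp, mul_nonneg hA.le hh]
    have s1 : B*Q ≤ (A-k)*(-c) := by linarith [mul_nonneg h.le (sub_nonneg.2 d1')]
    have s2 : (A-k)*X ≤ B*(-c) := by linarith [mul_nonneg h.le (sub_nonneg.2 d2')]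
    have s4 : 0 < A - k := by
      by_contra hh; push Not at hh
      linarith [mul_pos hB hQp, mul_nonneg_of_nonpos_of_nonpos hh s3.le]
    have := mul_le_mul s1 s2 (by positivity) (mul_nonneg s4.le (by linarith))
    have s7 : (B*(A-k))*(X*Q) ≤ (B*(A-k))*c^2 := by linarith
    have s8 := le_of_mul_le_mul_left s7 (mul_pos hB s4)
    linarith [sq_pos_of_pos h]

/-- dot and cross products based at the first point -/
def dt (a b c : Euc 2) : ℝ := (b 0 - a 0)*(c 0 - a 0) + (b 1 - a 1)*(c 1 - a 1)
def cr (a b c : Euc 2) : ℝ := (b 0 - a 0)*(c 1 - a 1) - (b 1 - a 1)*(c 0 - a 0)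

theorem euc_ext {p q : Euc 2} (h0 : p 0 = q 0) (h1 : p 1 = q 1) : p = q := by
  ext i; fin_cases i
  · exact h0
  · exact h1

theorem inner_dt (a b c : Euc 2) : ⟪b - a, c - a⟫ = dt a b c := by
  simp [PiLp.inner_apply, Fin.sum_univ_two, dt]; ring

theorem dn_symm {V : Finset (Euc 2)} {p q : Euc 2} (h : IsDNPair V p q) : IsDNPair V q p :=
  ⟨h.2.1, h.1, h.2.2.1.symm, fun v hv => (h.2.2.2 v hv).symm⟩

theorem dn1 {V : Finset (Euc 2)} {p q v : Euc 2} (h : IsDNPair V p q) (hv : v ∈ V) : 0 ≤ dt p v q := by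
  rw [← inner_dt]; exact (h.2.2.2 v hv).1

theorem dn2 {V : Finset (Euc 2)} {p q v : Euc 2} (h : IsDNPair V p q) (hv : v ∈ V) : 0 ≤ dt q v p :=
  dn1 (dn_symm h) hv

theorem norm_pos {p q : Euc 2} (h : p ≠ q) : 0 < (q 0 - p 0)*(q 0 - p 0) + (q 1 - p 1)*(q 1 - p 1) := by
  by_contra hh; push Not at hh
  obtain ⟨a1, a2⟩ := sq0 hh
  exact h (euc_ext (by linarith) (by linarith))

/-- rectangle lemma -/
theorem rect {V : Finset (Euc 2)} {v w x y : Euc 2} (hvw : IsDNPair V v w) (hx : IsDNPair V v x)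
    (hy : IsDNPair V w y) (cx : 0 < cr v w x) (cy : 0 < cr w v y) :
    x + y = v + w ∧ dt x v w = 0 := by
  have a1 := dn1 hx hvw.2.1
  have a2 := dn2 hx hvw.2.1
  have a3 := dn1 hx hy.2.1
  have b1 := dn1 hy hvw.1
  have b2 := dn2 hy hvw.1
  have b3 := dn1 hy hx.2.1
  have := core1 (w 0 - v 0) (w 1 - v 1) (x 0 - v 0) (x 1 - v 1) (y 0 - w 0) (y 1 - w 1)
    (by simp only [cr, dt] at *; linarith) (by simp only [cr, dt] at *; linarith)
    (by simp only [cr, dt] at *; linarith) (by simp only [cr, dt] at *; linarith)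
    (by simp only [cr, dt] at *; linarith) (by simp only [cr, dt] at *; linarith)
    (by simp only [cr, dt] at *; linarith) (by simp only [cr, dt] at *; linarith)
  obtain ⟨h1, h2, h3⟩ := this
  refine ⟨euc_ext ?_ ?_, ?_⟩
  · simp only [PiLp.add_apply]; linarith
  · simp only [PiLp.add_apply]; linarith
  · simp only [dt]; linarith

theorem cr_zero_eq {V : Finset (Euc 2)} {v w x : Euc 2} (hw : IsDNPair V v w) (hx : IsDNPair V v x)
    (h : cr v w x = 0) : w = x := by
  have a1 := dn2 hx hw.2.1
  have a2 := dn2 hw hx.2.1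
  have a3 := dn1 hx hw.2.1
  have p1 := norm_pos hw.2.2.1
  have p2 := norm_pos hx.2.2.1
  by_contra hne
  have p3 := norm_pos hne
  obtain ⟨c, hc⟩ : ∃ c, c = dt v w x := ⟨_, rfl⟩
  obtain ⟨P, hP⟩ : ∃ c, c = dt v w w := ⟨_, rfl⟩
  obtain ⟨Q, hQ⟩ : ∃ c, c = dt v x x := ⟨_, rfl⟩
  have i1 : c^2 + (cr v w x)^2 = P * Q := by subst_vars; simp only [cr, dt]; ring
  have k1 : c ≤ Q := by subst_vars; simp only [cr, dt] at *; linarith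
  have k2 : c ≤ P := by subst_vars; simp only [cr, dt] at *; linarith
  have k3 : 0 < P := by rw [hP]; exact p1
  have k4 : 0 < Q := by rw [hQ]; exact p2
  have k5 : 0 < P + Q - 2 * c := by subst_vars; simp only [cr, dt] at *; linarith
  rw [← hc] at a3
  rw [h] at i1
  clear hc hP hQ a1 a2 p1 p2 p3 h
  have k6 : c = Q ∧ c = P := by
    have : c * c = P * Q := by linarith
    have u1 : c * c ≤ c * Q := mul_le_mul_of_nonneg_left k1 a3
    have u2 : c * c ≤ c * P := mul_le_mul_of_nonneg_left k2 a3
    constructor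
    · by_contra hne
      have := lt_of_le_of_ne k1 hne
      nlinarith
    · by_contra hne
      have := lt_of_le_of_ne k2 hne
      nlinarith
  linarith [k6.1, k6.2]

theorem cr_trans {V : Finset (Euc 2)} {v a b c : Euc 2} (ha : IsDNPair V v a) (hb : IsDNPair V v b)
    (hc : IsDNPair V v c) (h1 : 0 < cr v a b) (h2 : 0 < cr v b c) : 0 < cr v a c := by
  have a1 := dn1 ha hb.2.1
  have a2 := dn1 hb hc.2.1
  have a3 := dn1 hc ha.2.1
  have pb := norm_pos hb.2.2.1
  have i1 : cr v a c * ((b 0 - v 0)*(b 0 - v 0) + (b 1 - v 1)*(b 1 - v 1)) =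
    cr v a b * dt v c b + dt v b a * cr v b c := by simp only [cr, dt]; ring
  have i2 : dt v a c * ((b 0 - v 0)*(b 0 - v 0) + (b 1 - v 1)*(b 1 - v 1)) =
    dt v b a * dt v c b - cr v a b * cr v b c := by simp only [cr, dt]; ring
  have h12 := mul_pos h1 h2
  have hpos : 0 < dt v b a * dt v c b := by nlinarith [mul_nonneg a3 pb.le]
  have k1 : 0 < dt v c b := by
    rcases a2.lt_or_eq with h | h
    · exact h
    · rw [← h] at hpos; simp at hpos
  have : 0 < cr v a c * ((b 0 - v 0)*(b 0 - v 0) + (b 1 - v 1)*(b 1 - v 1)) := by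
    rw [i1]; nlinarith [mul_pos h1 k1, mul_nonneg a1 h2.le]
  exact pos_of_mul_pos_left this pb.le

structure Gd (V : Finset (Euc 2)) (v w x y : Euc 2) : Prop where
  vw : IsDNPair V v w
  vx : IsDNPair V v x
  wy : IsDNPair V w y
  cx : 0 < cr v w x
  cy : 0 < cr w v y

theorem Gd.coords {V : Finset (Euc 2)} {v w x y : Euc 2} (h : Gd V v w x y) :
    w 0 = x 0 + y 0 - v 0 ∧ w 1 = x 1 + y 1 - v 1 ∧ dt v x y = 0 := by
  obtain ⟨h1, h2⟩ := rect h.vw h.vx h.wy h.cx h.cy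
  have e0 : (x + y) 0 = (v + w) 0 := by rw [h1]
  have e1 : (x + y) 1 = (v + w) 1 := by rw [h1]
  simp only [PiLp.add_apply] at e0 e1
  have k0 : w 0 = x 0 + y 0 - v 0 := by linarith
  have k1 : w 1 = x 1 + y 1 - v 1 := by linarith
  refine ⟨k0, k1, ?_⟩
  simp only [dt] at *
  rw [k0, k1] at h2
  linarith

theorem Gd.hullx {V : Finset (Euc 2)} {v w x y : Euc 2} (h : Gd V v w x y) : 0 < cr v y x := by
  obtain ⟨k0, k1, h2⟩ := h.coords
  have := h.cx
  simp only [cr] at *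
  rw [k0, k1] at this
  linarith

theorem Gd.hull {V : Finset (Euc 2)} {v w x y : Euc 2} (h : Gd V v w x y) {p : Euc 2} (hp : p ∈ V) :
    0 ≤ cr v y p := by
  obtain ⟨k0, k1, h2⟩ := h.coords
  have h3 := h.hullx
  have h4 := dn1 h.vx hp
  have h5 := norm_pos h.vx.2.2.1
  have i1 : cr v y p * ((x 0 - v 0)*(x 0 - v 0) + (x 1 - v 1)*(x 1 - v 1)) =
    dt v p x * cr v y x + cr v x p * dt v x y := by simp only [cr, dt]; ring
  rw [h2] at i1
  by_contra hh; push Not at hh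
  linarith [mul_nonneg h4 h3.le, mul_pos (neg_pos.2 hh) h5]

theorem Gd.ne {V : Finset (Euc 2)} {v w x y : Euc 2} (h : Gd V v w x y) : v ≠ y := by
  intro e
  have := h.hullx
  rw [← e] at this
  simp [cr] at this

theorem Gd.dpos {V : Finset (Euc 2)} {v w x y : Euc 2} (h : Gd V v w x y) : 0 < dt v y w := by
  obtain ⟨k0, k1, h2⟩ := h.coords
  have := norm_pos h.ne
  simp only [dt] at *
  rw [k0, k1]; linarith

theorem perp {a b c d : ℝ} (h : a*c+b*d = 0) (hp : 0 < c*c+d*d) : ∃ β, a = -β*d ∧ b = β*c := by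
  refine ⟨(b*c-a*d)/(c*c+d*d), ?_, ?_⟩
  · rw [← neg_div, div_mul_eq_mul_div, eq_div_iff hp.ne']; linear_combination c*h
  · rw [div_mul_eq_mul_div, eq_div_iff hp.ne']; linear_combination d*h

theorem para {a b c d : ℝ} (h : c*b-d*a = 0) (hp : 0 < c*c+d*d) : ∃ β, a = β*c ∧ b = β*d := by
  refine ⟨(a*c+b*d)/(c*c+d*d), ?_, ?_⟩
  · rw [div_mul_eq_mul_div, eq_div_iff hp.ne']; linear_combination (-d)*h
  · rw [div_mul_eq_mul_div, eq_div_iff hp.ne']; linear_combination c*h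

theorem Gd.inj {V : Finset (Euc 2)} {v1 w1 x1 v2 w2 x2 y : Euc 2} (h1 : Gd V v1 w1 x1 y)
    (h2 : Gd V v2 w2 x2 y) : v1 = v2 := by
  have a1 := h1.hull h2.vw.1
  have a2 := h2.hull h1.vw.1
  have b1 := dn1 h1.vw h2.vw.1
  have b2 := dn1 h2.vw h1.vw.1
  have c1 := h1.hullx
  have c2 := h2.hull h1.vx.2.1
  have d1 := h1.dpos
  have d2 := h2.dpos
  have n1 := norm_pos h1.ne
  have z : cr v1 y v2 = 0 := by simp only [cr] at *; linarith
  obtain ⟨μ, m0, m1⟩ := para (a := y 0 - v2 0) (b := y 1 - v2 1) (c := y 0 - v1 0) (d := y 1 - v1 1)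
    (by simp only [cr] at *; linarith) n1
  have e0 : v2 0 - v1 0 = (1-μ)*(y 0 - v1 0) := by linarith
  have e1 : v2 1 - v1 1 = (1-μ)*(y 1 - v1 1) := by linarith
  have f1 : dt v1 v2 w1 = (1-μ) * dt v1 y w1 := by simp only [dt]; rw [e0, e1]; ring
  have f2 : dt v2 y w2 = μ * ((y 0 - v1 0) * (w2 0 - v2 0) + (y 1 - v1 1) * (w2 1 - v2 1)) := by
    simp only [dt]; rw [m0, m1]; ring
  have f3 : dt v2 v1 w2 = (μ-1) * ((y 0 - v1 0) * (w2 0 - v2 0) + (y 1 - v1 1) * (w2 1 - v2 1)) := by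
    simp only [dt]; linear_combination -(w2 0 - v2 0) * e0 - (w2 1 - v2 1) * e1
  have f4 : cr v2 y x1 = μ * cr v1 y x1 := by
    simp only [cr]; linear_combination (x1 1 - y 1) * m0 - (x1 0 - y 0) * m1
  generalize (y 0 - v1 0) * (w2 0 - v2 0) + (y 1 - v1 1) * (w2 1 - v2 1) = D at *
  have mu1 : μ ≤ 1 := by
    by_contra hh; push Not at hh
    linarith [mul_pos (sub_pos.2 hh) d1]
  have mu0 : 0 ≤ μ := by
    by_contra hh; push Not at hh
    linarith [mul_pos (neg_pos.2 hh) c1]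
  have Dp : 0 < D := by
    rw [f2] at d2
    exact pos_of_mul_pos_right d2 mu0
  have mu : μ = 1 := by
    by_contra hh
    have := lt_of_le_of_ne mu1 hh
    linarith [mul_pos (sub_pos.2 this) Dp]
  subst mu
  exact euc_ext (by linarith) (by linarith)

theorem mid_edge {V : Finset (Euc 2)} {z t v w x y s1 s2 : Euc 2} (hz : IsDNPair V z t)
    (h : Gd V v w x y) (av : dt z v t = 0) (bv : 0 < cr z t v) (ay : dt z y t = 0) (by' : cr z t y < 0)
    (h1 : IsDNPair V t s1) (h2 : IsDNPair V t s2) : cr t s1 s2 = 0 := by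
  have hT := norm_pos hz.2.2.1
  obtain ⟨k0, k1, hp⟩ := h.coords
  obtain ⟨β, v0, v1⟩ := perp (a := v 0 - z 0) (b := v 1 - z 1) av hT
  obtain ⟨γ, y0, y1⟩ := perp (a := y 0 - z 0) (b := y 1 - z 1) ay hT
  have q1 := dn2 hz h.vx.2.1
  have q2 := dn2 h.vx hz.2.1
  have q3 := dn1 h.vx hz.2.1
  have hX := norm_pos h.vx.2.2.1
  have r1 := dn1 h1 h.vx.2.1
  have r2 := dn1 h1 h.vw.2.1
  have r3 := dn1 h2 h.vx.2.1
  have r4 := dn1 h2 h.vw.2.1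
  simp only [dt, cr] at *
  obtain ⟨T0, hT0⟩ : ∃ c, c = t 0 - z 0 := ⟨_, rfl⟩
  obtain ⟨T1, hT1⟩ : ∃ c, c = t 1 - z 1 := ⟨_, rfl⟩
  rw [← hT0] at hT v1 y1 bv by'
  rw [← hT1] at hT v0 y0 bv by'
  clear av ay
  rw [v0, v1] at bv
  rw [y0, y1] at by'
  have hβ : 0 < β := pos_of_mul_pos_left (b := T0*T0+T1*T1) (by linarith) hT.le
  have hγ : γ < 0 := by
    by_contra hh; push Not at hh
    linarith [mul_nonneg hh hT.le]
  have hN : T0 * (x 1 - v 1) - T1 * (x 0 - v 0) = 0 := by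
    have e0 : y 0 - v 0 = (β-γ)*T1 := by linarith
    have e1 : y 1 - v 1 = -(β-γ)*T0 := by linarith
    rw [e0, e1] at hp
    have : (β-γ)*(T0 * (x 1 - v 1) - T1 * (x 0 - v 0)) = 0 := by linarith
    exact (mul_eq_zero.1 this).resolve_left (by linarith)
  obtain ⟨l, l0, l1⟩ := para hN hT
  obtain ⟨K, hK⟩ : ∃ c, c = T0*T0+T1*T1 := ⟨_, rfl⟩
  rw [l0, l1] at hX
  have lne : l ≠ 0 := by rintro rfl; simp at hX
  have g1 : 0 ≤ (1-l)*K := by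
    have e0 : x 0 - t 0 = (l-1)*T0 - β*T1 := by linarith
    have e1 : x 1 - t 1 = (l-1)*T1 + β*T0 := by linarith
    have e2 : z 0 - t 0 = -T0 := by linarith
    have e3 : z 1 - t 1 = -T1 := by linarith
    rw [e0, e1, e2, e3] at q1
    rw [hK]; linarith
  have tv0 : t 0 - v 0 = T0 + β*T1 := by linarith
  have tv1 : t 1 - v 1 = T1 - β*T0 := by linarith
  have g2 : 0 ≤ l*K := by
    rw [tv0, tv1, l0, l1] at q3
    rw [hK]; linarith
  have g3 : 0 ≤ l*(l-1)*K := by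
    have e0 : t 0 - x 0 = (1-l)*T0 + β*T1 := by linarith
    have e1 : t 1 - x 1 = (1-l)*T1 - β*T0 := by linarith
    have e2 : v 0 - x 0 = -l*T0 := by linarith
    have e3 : v 1 - x 1 = -l*T1 := by linarith
    rw [e0, e1, e2, e3] at q2
    rw [hK]; linarith
  rw [← hK] at hT
  have lpos : 0 < l := lt_of_le_of_ne (nonneg_of_mul_nonneg_left g2 hT) lne.symm
  have le1 : 0 ≤ 1 - l := nonneg_of_mul_nonneg_left g1 hT
  have ge1 : 0 ≤ l * (l-1) := nonneg_of_mul_nonneg_left g3 hT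
  have ge2 : 0 ≤ l - 1 := nonneg_of_mul_nonneg_right ge1 lpos
  have l1e : l = 1 := by linarith
  subst l1e
  have x0 : x 0 - t 0 = -β*T1 := by linarith
  have x1 : x 1 - t 1 = β*T0 := by linarith
  have w0 : w 0 - t 0 = -γ*T1 := by linarith
  have w1 : w 1 - t 1 = γ*T0 := by linarith
  rw [x0, x1] at r1 r3
  rw [w0, w1] at r2 r4
  have key : ∀ a b : ℝ, 0 ≤ -β*T1*a+β*T0*b → 0 ≤ -γ*T1*a+γ*T0*b → T0*b-T1*a = 0 := by
    intro a b u1 u2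
    have u1' : 0 ≤ β*(T0*b-T1*a) := by linarith
    have u2' : 0 ≤ (-γ)*(-(T0*b-T1*a)) := by linarith
    have := nonneg_of_mul_nonneg_right u1' hβ
    have := nonneg_of_mul_nonneg_right u2' (neg_pos.2 hγ)
    linarith
  have hT' : 0 < T0*T0+T1*T1 := by rw [← hK]; exact hT
  obtain ⟨c1, i1, i2⟩ := para (key _ _ r1 r2) hT'
  obtain ⟨c2, i3, i4⟩ := para (key _ _ r3 r4) hT'
  rw [i1, i2, i3, i4]; ring

theorem cr_cyc (a b c : Euc 2) : cr a b c = cr b c a := by simp only [cr]; ring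
theorem cr_anti (a b c : Euc 2) : cr a b c = - cr a c b := by simp only [cr]; ring

theorem no_edge {V M : Finset (Euc 2)} {z t : Euc 2} (hMV : M ⊆ V) (hz : z ∉ M)
    (hM : ∀ p ∈ V, p = z ∨ p ∈ M) (m f g : Euc 2 → Euc 2)
    (G : ∀ v ∈ M, Gd V v (m v) (f v) (g v)) (hg : ∀ v ∈ M, g v ∈ M) (ht : IsDNPair V z t) : False := by
  have hK := norm_pos ht.2.2.1
  have htM : t ∈ M := (hM t ht.2.1).resolve_left ht.2.2.1.symm
  have apos : ∀ p ∈ M, 0 ≤ dt z p t := fun p hp => dn1 ht (hMV hp)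
  have hzV : z ∈ V := ht.1
  have at' : 0 < dt z t t := hK
  have bt : cr z t t = 0 := by simp only [cr]; ring
  -- identity in the (a,b) frame
  have id1 : ∀ p q, dt z p t * cr z t q - cr z t p * dt z q t = dt z t t * cr z p q := by
    intro p q; simp only [dt, cr]; ring
  have id2 : ∀ p q r, dt z t t * cr p q r = (dt z q t - dt z p t) * (cr z t r - cr z t p)
      - (cr z t q - cr z t p) * (dt z r t - dt z p t) := by
    intro p q r; simp only [dt, cr]; ring
  have hne : ∀ p ∈ M, dt z p t = 0 → cr z t p ≠ 0 := by
    intro p hp h1 h2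
    have : p ≠ z := by rintro rfl; exact hz hp
    have n := norm_pos this.symm
    have : ((p 0 - z 0)*(p 0 - z 0) + (p 1 - z 1)*(p 1 - z 1)) * dt z t t = (dt z p t)^2 + (cr z t p)^2 := by
      simp only [dt, cr]; ring
    rw [h1, h2] at this
    have := mul_pos n at'
    linarith
  have mono : ∀ v ∈ M, 0 ≤ dt z v t * cr z t (g v) - cr z t v * dt z (g v) t := by
    intro v hv
    rw [id1]
    have := (G v hv).hull hzV
    rw [← cr_cyc] at this
    exact mul_nonneg at'.le this
  by_cases hA : ∃ v ∈ M, dt z v t = 0 ∧ 0 < cr z t v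
  · obtain ⟨v0, hv0, h0⟩ := hA
    obtain ⟨v, hv, hmin⟩ := (M.filter fun v => dt z v t = 0 ∧ 0 < cr z t v).exists_min_image
      (fun v => cr z t v) ⟨v0, by simp [hv0, h0]⟩
    simp only [Finset.mem_filter] at hv hmin
    obtain ⟨hv, a0, b0⟩ := hv
    have hm := mono v hv
    rw [a0] at hm
    have ag : dt z (g v) t = 0 := by
      refine le_antisymm ?_ (apos _ (hg v hv))
      by_contra hh; push Not at hh
      linarith [mul_pos b0 hh]
    have bg := hne _ (hg v hv) ag
    rcases lt_or_gt_of_ne bg with h | h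
    · have := mid_edge ht (G v hv) a0 b0 ag h (G t htM).vw (G t htM).vx
      have := (G t htM).cx
      linarith
    · have h1 := hmin (g v) ⟨hg v hv, ag, h⟩
      have h2 := (G v hv).hull ht.2.1
      have h3 := id2 v (g v) t
      rw [ag, a0, bt] at h3
      have h4 : cr z t (g v) = cr z t v := by
        refine le_antisymm ?_ h1
        by_contra hh; push Not at hh
        linarith [mul_pos (sub_pos.2 hh) at', mul_nonneg at'.le h2]
      have h5 := (G v hv).hullx
      have h6 := id2 v (g v) (f v)
      rw [ag, a0, h4] at h6
      linarith [mul_pos at' h5]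
  · push Not at hA
    obtain ⟨v0, hv0, hmax⟩ := (M.filter fun v => 0 < dt z v t).exists_max_image
      (fun v => cr z t v / dt z v t) ⟨t, by simp [htM, at']⟩
    simp only [Finset.mem_filter] at hv0 hmax
    obtain ⟨v, hv, hmin⟩ := (M.filter fun v => 0 < dt z v t ∧ cr z t v / dt z v t = cr z t v0 / dt z v0 t).exists_min_image
      (fun v => dt z v t) ⟨v0, by simp [hv0]⟩
    simp only [Finset.mem_filter] at hv hmin
    obtain ⟨hv, av, sv⟩ := hv
    rw [← sv] at hmax hmin
    have hm := mono v hv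
    have ag : 0 < dt z (g v) t := by
      refine lt_of_le_of_ne (apos _ (hg v hv)) fun h => ?_
      have h1 := hA _ (hg v hv) h.symm
      have h2 := hne _ (hg v hv) h.symm
      have h3 := lt_of_le_of_ne h1 h2
      rw [← h] at hm
      linarith [mul_pos av (neg_pos.2 h3)]
    have s1 := hmax _ ⟨hg v hv, ag⟩
    have s2 : cr z t v / dt z v t ≤ cr z t (g v) / dt z (g v) t := by
      rw [div_le_div_iff₀ av ag]; linarith
    have s3 := le_antisymm s1 s2
    have m1 := hmin (g v) ⟨hg v hv, ag, s3⟩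
    rw [div_eq_div_iff ag.ne' av.ne'] at s3
    have hx := (G v hv).hullx
    have hq : dt z v t * cr z t (f v) - cr z t v * dt z (f v) t ≤ 0 := by
      rcases hM (f v) (G v hv).vx.2.1 with h | h
      · rw [h]; simp [dt, cr]
      · rcases (apos _ h).lt_or_eq with h1 | h1
        · have := hmax _ ⟨h, h1⟩
          rw [div_le_div_iff₀ h1 av] at this
          linarith
        · have := hA _ h h1.symm
          rw [← h1]
          linarith [mul_nonneg av.le (neg_nonneg.2 this)]
    have h6 := id2 v (g v) (f v)
    have h7 : dt z v t * (dt z t t * cr v (g v) (f v)) =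
      (dt z (g v) t - dt z v t) * (dt z v t * cr z t (f v) - cr z t v * dt z (f v) t) := by
      rw [h6]; linear_combination (dt z v t - dt z (f v) t) * s3
    have h8 := mul_pos av (mul_pos at' hx)
    rw [h7] at h8
    linarith [mul_nonneg (sub_nonneg.2 m1) (neg_nonneg.2 hq)]

def Mk (V : Finset (Euc 2)) (v w : Euc 2) : Prop :=
  IsDNPair V v w ∧ ∀ x, IsDNPair V v x → cr v w x ≤ 0

def Un (V : Finset (Euc 2)) (v w : Euc 2) : Prop := ∃ x y, Gd V v w x y

theorem mk_unique {V : Finset (Euc 2)} {v w1 w2 : Euc 2} (h1 : Mk V v w1) (h2 : Mk V v w2) : w1 = w2 := by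
  have a := h1.2 w2 h2.1
  have b := h2.2 w1 h1.1
  rw [cr_anti] at b
  exact cr_zero_eq h1.1 h2.1 (by linarith)

theorem Gd.symm {V : Finset (Euc 2)} {v w x y : Euc 2} (h : Gd V v w x y) : Gd V w v y x :=
  ⟨dn_symm h.vw, h.wy, h.vx, h.cy, h.cx⟩

theorem un_symm {V : Finset (Euc 2)} {v w : Euc 2} (h : Un V v w) : Un V w v := by
  obtain ⟨x, y, h⟩ := h
  exact ⟨y, x, h.symm⟩

theorem un_unique {V : Finset (Euc 2)} {v w1 w2 : Euc 2} (h1 : Un V v w1) (h2 : Un V v w2) : w1 = w2 := by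
  have key : ∀ {w1 w2 : Euc 2}, Un V v w1 → Un V v w2 → ¬ 0 < cr v w1 w2 := by
    rintro w1 w2 ⟨x1, y1, g1⟩ ⟨x2, y2, g2⟩ hc
    have t := cr_trans g1.vw g2.vw g2.vx hc g2.cx
    have r1 := (rect g1.vw g2.vw g1.wy hc g1.cy).1
    have r2 := (rect g1.vw g2.vx g1.wy t g1.cy).1
    have e : w2 = x2 := add_right_cancel (r1.trans r2.symm)
    have := g2.cx
    rw [← e] at this
    simp only [cr] at this; linarith
  have a := key h1 h2
  have b := key h2 h1
  rw [cr_anti] at b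
  obtain ⟨_, _, g1⟩ := h1
  obtain ⟨_, _, g2⟩ := h2
  exact cr_zero_eq g1.vw g2.vw (by linarith)

theorem trich {V : Finset (Euc 2)} {v w : Euc 2} (h : IsDNPair V v w) : Mk V v w ∨ Mk V w v ∨ Un V v w := by
  by_cases h1 : Mk V v w
  · exact Or.inl h1
  by_cases h2 : Mk V w v
  · exact Or.inr (Or.inl h2)
  right; right
  simp only [Mk, not_and, not_forall, not_le] at h1 h2
  obtain ⟨x, hx, cx⟩ := h1 h
  obtain ⟨y, hy, cy⟩ := h2 (dn_symm h)
  exact ⟨x, y, h, hx, hy, cx, cy⟩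

theorem sum_arg {V M : Finset (Euc 2)} {z : Euc 2} (hMV : M ⊆ V) (hz : z ∉ M) (hzV : z ∈ V)
    (hM : ∀ p ∈ V, p = z ∨ p ∈ M) (m f g : Euc 2 → Euc 2)
    (G : ∀ v ∈ M, Gd V v (m v) (f v) (g v)) (hm : ∀ v ∈ M, m v ∈ M) (hmm : ∀ v ∈ M, m (m v) = v) :
    ∀ v ∈ M, g v ∈ M := by
  have hV : V = insert z M := by
    ext p; simp only [Finset.mem_insert]
    exact ⟨hM p, fun h => h.elim (fun h => h ▸ hzV) (fun h => hMV h)⟩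
  have inj : Set.InjOn g M := by
    intro a ha b hb hab
    have h1 := G a ha
    have h2 := G b hb
    rw [← hab] at h2
    exact h1.inj h2
  have hadd : ∀ v ∈ M, g (m v) + g v = v + m v := by
    intro v hv
    have h1 := G v hv
    have h2 := G (m v) (hm v hv)
    rw [hmm v hv] at h2
    exact (rect h1.vw h2.wy h1.wy h2.cy h1.cy).1
  have hperm : ∀ F : Euc 2 → Euc 2, ∑ v ∈ M, F (m v) = ∑ v ∈ M, F v := by
    intro F
    exact Finset.sum_nbij' m m hm hm hmm hmm (fun _ _ => rfl)
  have hsum : ∑ v ∈ M, g v = ∑ v ∈ M, v := by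
    have h1 : ∑ v ∈ M, (g (m v) + g v) = ∑ v ∈ M, (v + m v) := Finset.sum_congr rfl hadd
    rw [Finset.sum_add_distrib, Finset.sum_add_distrib, hperm g, hperm (fun v => v), ← two_smul ℝ, ← two_smul ℝ] at h1
    exact smul_right_injective _ (two_ne_zero' ℝ) h1
  have gV : M.image g ⊆ V := by
    intro p hp
    obtain ⟨v, hv, rfl⟩ := Finset.mem_image.1 hp
    exact (G v hv).wy.2.1
  have hcard : (V \ M.image g).card = 1 := by
    rw [Finset.card_sdiff_of_subset gV, Finset.card_image_of_injOn inj, hV, Finset.card_insert_of_notMem hz]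
    omega
  obtain ⟨c, hc⟩ := Finset.card_eq_one.1 hcard
  have s1 : ∑ p ∈ V, p = c + ∑ p ∈ M, p := by
    rw [← Finset.sum_sdiff gV, hc, Finset.sum_singleton, Finset.sum_image inj, hsum]
  have s2 : ∑ p ∈ V, p = z + ∑ p ∈ M, p := by
    rw [hV, Finset.sum_insert hz]
  have hcz : c = z := add_right_cancel (s1.symm.trans s2)
  intro v hv
  refine (hM (g v) (G v hv).wy.2.1).resolve_left fun h => ?_
  have : c ∈ V \ M.image g := by rw [hc]; simp
  rw [hcz, ← h] at this
  exact (Finset.mem_sdiff.1 this).2 (Finset.mem_image_of_mem g hv)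

theorem un_data (V : Finset (Euc 2)) : ∃ m f g : Euc 2 → Euc 2,
    ∀ v ∈ V.filter (fun v => ∃ w, Un V v w), Gd V v (m v) (f v) (g v) := by
  have : ∀ v, ∃ w x y, v ∈ V.filter (fun v => ∃ w, Un V v w) → Gd V v w x y := by
    intro v
    by_cases h : v ∈ V.filter (fun v => ∃ w, Un V v w)
    · obtain ⟨w, x, y, h'⟩ := (Finset.mem_filter.1 h).2
      exact ⟨w, x, y, fun _ => h'⟩
    · exact ⟨v, v, v, fun h' => absurd h' h⟩
  choose m f g h using this
  exact ⟨m, f, g, h⟩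

theorem count (V : Finset (Euc 2)) :
    ((V ×ˢ V).filter fun pq => IsDNPair V pq.1 pq.2).card ≤
      2 * (V.filter fun v => ∃ w, IsDNPair V v w).card + (V.filter fun v => ∃ w, Un V v w).card := by
  set A := (V ×ˢ V).filter fun pq => IsDNPair V pq.1 pq.2
  set K := (V ×ˢ V).filter fun pq => Mk V pq.1 pq.2
  set U := (V ×ˢ V).filter fun pq => Un V pq.1 pq.2
  have hsub : A ⊆ K ∪ K.image Prod.swap ∪ U := by
    rintro ⟨p, q⟩ h
    simp only [A, Finset.mem_filter, Finset.mem_product] at h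
    simp only [K, U, Finset.mem_union, Finset.mem_image, Finset.mem_filter, Finset.mem_product]
    rcases trich h.2 with h1 | h1 | h1
    · exact Or.inl (Or.inl ⟨h.1, h1⟩)
    · exact Or.inl (Or.inr ⟨(q, p), ⟨⟨h.1.2, h.1.1⟩, h1⟩, rfl⟩)
    · exact Or.inr ⟨h.1, h1⟩
  have h1 := Finset.card_le_card hsub
  have h2 := Finset.card_union_le (K ∪ K.image Prod.swap) U
  have h3 := Finset.card_union_le K (K.image Prod.swap)
  have h4 : (K.image Prod.swap).card ≤ K.card := Finset.card_image_le
  have h5 : K.card ≤ (V.filter fun v => ∃ w, IsDNPair V v w).card := by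
    apply Finset.card_le_card_of_injOn Prod.fst
    · rintro ⟨p, q⟩ h
      simp only [K, Finset.coe_filter, Finset.mem_product, Set.mem_ofPred_eq] at h ⊢
      exact ⟨h.1.1, q, h.2.1⟩
    · rintro ⟨p, q⟩ h ⟨p', q'⟩ h' e
      simp only [K, Finset.coe_filter, Finset.mem_product, Set.mem_ofPred_eq] at h h' e
      subst e
      rw [mk_unique h.2 h'.2]
  have h6 : U.card ≤ (V.filter fun v => ∃ w, Un V v w).card := by
    apply Finset.card_le_card_of_injOn Prod.fst
    · rintro ⟨p, q⟩ h
      simp only [U, Finset.coe_filter, Finset.mem_product, Set.mem_ofPred_eq] at h ⊢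
      exact ⟨h.1.1, q, h.2⟩
    · rintro ⟨p, q⟩ h ⟨p', q'⟩ h' e
      simp only [U, Finset.coe_filter, Finset.mem_product, Set.mem_ofPred_eq] at h h' e
      subst e
      rw [un_unique h.2 h'.2]
  omega

/-- A set of at least 3 points in the plane has at most `3⌊n/2⌋` double-normal pairs. -/
theorem doubleNormal_plane_upper_bound (V : Finset (Euc 2)) (hV : 3 ≤ V.card) :
    numDN V ≤ 3 * (V.card / 2) := by
  unfold numDN
  have hc := count V
  obtain ⟨m, f, g, G⟩ := un_data V
  have hN : (V.filter fun v => ∃ w, IsDNPair V v w).card ≤ V.card := Finset.card_filter_le _ _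
  have hMc : (V.filter fun v => ∃ w, Un V v w).card ≤ V.card := Finset.card_filter_le _ _
  set M := V.filter fun v => ∃ w, Un V v w with hMd
  have hMV : M ⊆ V := Finset.filter_subset _ _
  have hm : ∀ v ∈ M, m v ∈ M := by
    intro v hv
    have h := G v hv
    exact Finset.mem_filter.2 ⟨h.vw.2.1, v, _, _, h.symm⟩
  have hmm : ∀ v ∈ M, m (m v) = v := by
    intro v hv
    exact un_unique ⟨_, _, G _ (hm v hv)⟩ ⟨_, _, (G v hv).symm⟩
  have heven : Even M.card := by
    have : ∑ v ∈ M, (1 : ZMod 2) = 0 :=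
      Finset.sum_involution (fun v _ => m v) (fun _ _ => by decide)
        (fun v hv _ => (G v hv).vw.2.2.1.symm) (fun v hv => hm v hv) (fun v hv => hmm v hv)
    rw [Finset.sum_const, nsmul_eq_mul, mul_one] at this
    exact (ZMod.natCast_eq_zero_iff_even).1 this
  rcases Nat.even_or_odd V.card with he | ho
  · obtain ⟨k, hk⟩ := he
    omega
  · obtain ⟨k, hk⟩ := ho
    obtain ⟨j, hj⟩ := heven
    by_cases hlt : M.card + 2 ≤ V.card
    · omega
    have hM1 : M.card + 1 = V.card := by omega
    have hd : (V \ M).card = 1 := by rw [Finset.card_sdiff_of_subset hMV]; omega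
    obtain ⟨z, hz⟩ := Finset.card_eq_one.1 hd
    have hzm : z ∈ V \ M := by rw [hz]; simp
    obtain ⟨hzV, hzM⟩ := Finset.mem_sdiff.1 hzm
    have hall : ∀ p ∈ V, p = z ∨ p ∈ M := by
      intro p hp
      by_cases h : p ∈ M
      · exact Or.inr h
      · left
        have : p ∈ V \ M := Finset.mem_sdiff.2 ⟨hp, h⟩
        rw [hz] at this
        simpa using this
    have hg := sum_arg hMV hzM hzV hall m f g G hm hmm
    have hNM : (V.filter fun v => ∃ w, IsDNPair V v w) ⊆ M := by
      intro p hp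
      obtain ⟨hp, w, hw⟩ := Finset.mem_filter.1 hp
      refine (hall p hp).resolve_left ?_
      rintro rfl
      exact no_edge hMV hzM hall m f g G hg hw
    have := Finset.card_le_card hNM
    omega
end
end

section
/- Let n ≥ 4 be an even integer and let V be a set of n points in the Euclidean plane ℝ² such that for some c ∈ ℝ² and r > 0 one has ‖v − c‖ = r for every v ∈ V, and such that 2c − v ∈ V for every v ∈ V (V lies on a circle and is symmetric with respect to its centre). Then N(V) = 3n/2. -/
open scoped RealInnerProductSpace Classical

noncomputable section

lemma aux_key {α : Type*} (V : Finset α) (x y : α → ℝ)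
    (hc : ∀ v ∈ V, x v ^ 2 + y v ^ 2 = 1)
    (hinj : ∀ v ∈ V, ∀ w ∈ V, x v = x w → y v = y w → v = w)
    (hneg : ∀ v ∈ V, ∃ w ∈ V, x w = - x v ∧ y w = - y v)
    (hne : ∃ v ∈ V, y v ≠ 0) :
    ∃ q ∈ V, 0 < y q ∧ ∀ q' ∈ V, 0 < y q' →
      ((∀ w ∈ V, 0 ≤ y w * y q' + (1 - x w) * (1 - x q')) ↔ q' = q) := by
  have hU : (V.filter fun v => 0 < y v).Nonempty := by
    obtain ⟨v, hv, h⟩ := hne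
    rcases lt_or_gt_of_ne h with h | h
    · obtain ⟨w, hw, h1, h2⟩ := hneg v hv
      exact ⟨w, by simp [hw, h2, h]⟩
    · exact ⟨v, by simp [hv, h]⟩
  obtain ⟨q, hq, hmin⟩ := Finset.exists_min_image _ x hU
  simp only [Finset.mem_filter] at hq hmin
  obtain ⟨hqV, hq0⟩ := hq
  have hb : ∀ v ∈ V, x v ≤ 1 ∧ -1 ≤ x v := fun v hv => by
    have := hc v hv
    constructor <;> nlinarith [sq_nonneg (y v)]
  have hb' : ∀ v ∈ V, 0 < y v → x v < 1 ∧ -1 < x v := fun v hv h => by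
    have := hc v hv
    have : 0 < y v ^ 2 := by positivity
    constructor <;> nlinarith
  refine ⟨q, hqV, hq0, fun q' hq' hy' => ⟨fun H => ?_, ?_⟩⟩
  · have hle : x q' ≤ x q := by
      obtain ⟨w, hw, h1, h2⟩ := hneg q hqV
      have h := H w hw
      rw [h1, h2] at h
      have h3 : y q * y q' ≤ (1 + x q) * (1 - x q') := by linarith
      have h4 : (y q * y q') ^ 2 ≤ ((1 + x q) * (1 - x q')) ^ 2 :=
        pow_le_pow_left₀ (by positivity) h3 2
      have e1 : y q ^ 2 = 1 - x q ^ 2 := by linarith [hc q hqV]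
      have e2 : y q' ^ 2 = 1 - x q' ^ 2 := by linarith [hc q' hq']
      rw [mul_pow, e1, e2] at h4
      have p1 := (hb' q hqV hq0).2
      have p2 := (hb' q' hq' hy').1
      have hp : 0 < (1 + x q) * (1 - x q') := mul_pos (by linarith) (by linarith)
      have h5 : ((1 + x q) * (1 - x q')) * ((1 - x q) * (1 + x q'))
        ≤ ((1 + x q) * (1 - x q')) * ((1 + x q) * (1 - x q')) := by nlinarith
      have h6 := le_of_mul_le_mul_left h5 hp
      nlinarith
    have hx : x q' = x q := le_antisymm hle (hmin q' ⟨hq', hy'⟩)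
    have hy : y q' ^ 2 = y q ^ 2 := by
      have := hc q hqV
      have := hc q' hq'
      rw [hx] at this
      linarith
    exact hinj _ hq' _ hqV hx ((sq_eq_sq₀ hy'.le hq0.le).1 hy)
  · rintro rfl w hw
    have p2 := (hb' q' hq' hy').1
    have p1 := hb w hw
    by_cases h0 : 0 ≤ y w
    · have := mul_nonneg h0 hy'.le
      have := mul_nonneg (sub_nonneg.2 p1.1) (sub_nonneg.2 p2.le)
      linarith
    · push Not at h0
      obtain ⟨u, hu, h1, h2⟩ := hneg w hw
      have hu0 : 0 < y u := by linarith
      have hm := hmin u ⟨hu, hu0⟩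
      have p3 := hb' u hu hu0
      have ew : y w = - y u := by linarith
      have ex : x w = - x u := by linarith
      have e1 : y u ^ 2 = 1 - x u ^ 2 := by linarith [hc u hu]
      have e2 : y q' ^ 2 = 1 - x q' ^ 2 := by linarith [hc q' hq']
      have hp : 0 < (1 + x u) * (1 - x q') := mul_pos (by linarith) (by linarith)
      have h6 : (1 - x u) * (1 + x q') ≤ (1 + x u) * (1 - x q') := by nlinarith
      have h5 := mul_le_mul_of_nonneg_left h6 hp.le
      have h4 : (y u * y q') ^ 2 ≤ ((1 + x u) * (1 - x q')) ^ 2 := by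
        rw [mul_pow, e1, e2]; nlinarith
      have h3 := (sq_le_sq₀ (mul_pos hu0 hy').le hp.le).1 h4
      rw [ew, ex]; linarith

lemma aux_three (V : Finset (Euc 2)) (hcard : 4 ≤ V.card) (c : Euc 2) (r : ℝ) (hr : 0 < r)
    (hcirc : ∀ v ∈ V, ‖v - c‖ = r) (hsym : ∀ v ∈ V, (2 : ℝ) • c - v ∈ V)
    (p : Euc 2) (hp : p ∈ V) :
    (V.filter fun q => IsDNPair V p q).card = 3 := by
  have hr2 : 0 < r ^ 2 := by positivity
  have hn : ∀ v ∈ V, (v 0 - c 0) ^ 2 + (v 1 - c 1) ^ 2 = r ^ 2 := by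
    intro v hv
    have := hcirc v hv
    rw [← this, EuclideanSpace.norm_sq_eq]
    simp [Fin.sum_univ_two]
  have ha := hn p hp
  obtain ⟨A, hA⟩ : ∃ A, A = p 0 - c 0 := ⟨_, rfl⟩
  obtain ⟨B, hB⟩ : ∃ B, B = p 1 - c 1 := ⟨_, rfl⟩
  rw [← hA, ← hB] at ha
  obtain ⟨x, hx⟩ : ∃ x : Euc 2 → ℝ, x = fun v => ((v 0 - c 0) * A + (v 1 - c 1) * B) / r ^ 2 :=
    ⟨_, rfl⟩
  obtain ⟨y, hy⟩ : ∃ y : Euc 2 → ℝ, y = fun v => ((v 1 - c 1) * A - (v 0 - c 0) * B) / r ^ 2 :=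
    ⟨_, rfl⟩
  have hv0 : ∀ v : Euc 2, v 0 = c 0 + (x v * A - y v * B) := by
    intro v
    simp only [hx, hy]
    field_simp
    rw [← ha]; ring
  have hv1 : ∀ v : Euc 2, v 1 = c 1 + (x v * B + y v * A) := by
    intro v
    simp only [hx, hy]
    field_simp
    rw [← ha]; ring
  have hinj : ∀ v w : Euc 2, x v = x w → y v = y w → v = w := by
    intro v w h1 h2
    ext i
    fin_cases i
    · show v 0 = w 0
      rw [hv0 v, hv0 w, h1, h2]
    · show v 1 = w 1
      rw [hv1 v, hv1 w, h1, h2]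
  have hc : ∀ v ∈ V, x v ^ 2 + y v ^ 2 = 1 := by
    intro v hv
    have h := hn v hv
    rw [hv0 v, hv1 v] at h
    have : r ^ 2 * (x v ^ 2 + y v ^ 2) = r ^ 2 * 1 := by
      rw [mul_one]; nth_rewrite 2 [← h]; rw [← ha]; ring
    exact mul_left_cancel₀ hr2.ne' this
  have hxn : ∀ v : Euc 2, x ((2 : ℝ) • c - v) = - x v := by
    intro v; simp only [hx]; simp; ring
  have hyn : ∀ v : Euc 2, y ((2 : ℝ) • c - v) = - y v := by
    intro v; simp only [hy]; simp; ring
  have hxp : x p = 1 := by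
    simp only [hx]; rw [← hA, ← hB, ← ha]; rw [← ha] at hr2; field_simp
  have hyp : y p = 0 := by
    simp only [hy]; rw [← hA, ← hB]; ring
  have hin1 : ∀ w q : Euc 2, ⟪w - p, q - p⟫ = r ^ 2 * (y w * y q + (1 - x w) * (1 - x q)) := by
    intro w q
    simp only [PiLp.inner_apply, Fin.sum_univ_two, PiLp.sub_apply, RCLike.inner_apply, conj_trivial]
    rw [hv0 w, hv0 q, hv1 w, hv1 q, hv0 p, hv1 p, hxp, hyp, ← ha]; ring
  have hin2 : ∀ w, ∀ q ∈ V, ⟪w - q, p - q⟫ = r ^ 2 * (- y w * y q + (1 + x w) * (1 - x q)) := by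
    intro w q hq
    have := hc q hq
    simp only [PiLp.inner_apply, Fin.sum_univ_two, PiLp.sub_apply, RCLike.inner_apply, conj_trivial]
    rw [hv0 w, hv0 q, hv1 w, hv1 q, hv0 p, hv1 p, hxp, hyp, ← ha]
    linear_combination (A ^ 2 + B ^ 2) * this
  have hDN : ∀ q ∈ V, (IsDNPair V p q ↔
      q ≠ p ∧ ∀ w ∈ V, 0 ≤ y w * y q + (1 - x w) * (1 - x q)) := by
    intro q hq
    constructor
    · rintro ⟨-, -, h, H⟩
      refine ⟨h.symm, fun w hw => ?_⟩
      have := (H w hw).1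
      rw [hin1] at this
      exact nonneg_of_mul_nonneg_right this hr2
    · rintro ⟨h, H⟩
      refine ⟨hp, hq, h.symm, fun w hw => ⟨?_, ?_⟩⟩
      · rw [hin1]; exact mul_nonneg hr2.le (H w hw)
      · rw [hin2 w q hq]
        have := H _ (hsym w hw)
        rw [hxn, hyn] at this
        refine mul_nonneg hr2.le ?_
        linarith
  have hy0 : ∀ v ∈ V, y v = 0 → v = p ∨ v = (2 : ℝ) • c - p := by
    intro v hv h
    have h1 := hc v hv
    rw [h] at h1
    have h2 : (x v - 1) * (x v + 1) = 0 := by linarith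
    rcases mul_eq_zero.1 h2 with h2 | h2
    · left; exact hinj _ _ (by linarith) (by linarith)
    · right; apply hinj
      · rw [hxn]; linarith
      · rw [hyn]; linarith
  have hne : ∃ v ∈ V, y v ≠ 0 := by
    by_contra! h
    have : V ⊆ {p, (2 : ℝ) • c - p} := by
      intro v hv
      simpa using hy0 v hv (h v hv)
    have := Finset.card_le_card this
    have := Finset.card_le_two (a := p) (b := (2 : ℝ) • c - p)
    omega
  obtain ⟨q1, hq1, hp1, H1⟩ := aux_key V x y hc (fun v _ w _ => hinj v w)
    (fun v hv => ⟨_, hsym v hv, hxn v, hyn v⟩) hne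
  obtain ⟨q2, hq2, hp2, H2⟩ := aux_key V x (fun v => - y v)
    (fun v hv => by simpa using hc v hv) (fun v _ w _ h1 h2 => hinj v w h1 (neg_injective h2))
    (fun v hv => ⟨_, hsym v hv, hxn v, by rw [hyn]⟩) (by simpa using hne)
  simp only [neg_mul_neg] at H2
  have hyq : y ((2 : ℝ) • c - p) = 0 := by rw [hyn, hyp, neg_zero]
  have hxq : x ((2 : ℝ) • c - p) = -1 := by rw [hxn, hxp]
  have hset : (V.filter fun q => IsDNPair V p q) = {(2 : ℝ) • c - p, q1, q2} := by
    ext q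
    simp only [Finset.mem_filter, Finset.mem_insert, Finset.mem_singleton]
    constructor
    · rintro ⟨hq, h⟩
      obtain ⟨hqp, h⟩ := (hDN q hq).1 h
      rcases lt_trichotomy (y q) 0 with h0 | h0 | h0
      · right; right; exact (H2 q hq (by linarith)).1 h
      · left; exact (hy0 q hq h0).resolve_left hqp
      · right; left; exact (H1 q hq h0).1 h
    · rintro (rfl | rfl | rfl)
      · refine ⟨hsym p hp, (hDN _ (hsym p hp)).2 ⟨fun h => ?_, fun w hw => ?_⟩⟩
        · rw [h] at hxq; linarith
        · rw [hyq, hxq]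
          nlinarith [hc w hw, sq_nonneg (y w)]
      · refine ⟨hq1, (hDN _ hq1).2 ⟨fun h => ?_, (H1 _ hq1 hp1).2 rfl⟩⟩
        rw [h] at hp1; linarith
      · refine ⟨hq2, (hDN _ hq2).2 ⟨fun h => ?_, (H2 _ hq2 hp2).2 rfl⟩⟩
        rw [h] at hp2; linarith
  rw [hset]
  refine Finset.card_eq_three.2 ⟨_, _, _, ?_, ?_, ?_, rfl⟩
  · intro h; rw [← h] at hp1; linarith
  · intro h; rw [← h] at hp2; linarith
  · intro h; rw [← h] at hp2; linarith

/-- If `n ≥ 4` is even and `V` is a set of `n` points on a circle, symmetric with respect to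
the centre of the circle, then `N(V) = 3n/2`. -/
theorem doubleNormal_plane_symmetric_circle (n : ℕ) (hn : 4 ≤ n) (heven : Even n)
    (V : Finset (Euc 2)) (hcard : V.card = n) (c : Euc 2) (r : ℝ) (hr : 0 < r)
    (hcirc : ∀ v ∈ V, ‖v - c‖ = r) (hsym : ∀ v ∈ V, (2 : ℝ) • c - v ∈ V) :
    2 * numDN V = 3 * n := by
  have h : ((V ×ˢ V).filter fun pq => IsDNPair V pq.1 pq.2).card = 3 * n := by
    rw [Finset.card_filter, Finset.sum_product]
    have : ∀ p ∈ V, (∑ q ∈ V, if IsDNPair V p q then 1 else 0) = 3 := by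
      intro p hp
      rw [← Finset.card_filter]
      exact aux_three V (by omega) c r hr hcirc hsym p hp
    rw [Finset.sum_congr rfl this, Finset.sum_const, hcard, smul_eq_mul, mul_comm]
  unfold numDN
  rw [h]
  obtain ⟨k, rfl⟩ := heven
  omega
end
end
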